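/- Let N be a finite type, let J_s be a symmetric real N×N matrix, let ε be a real number and ℏ > 0 a real constant, and let P^A, P^B : ℕ → Matrix N N ℝ satisfy P^A_{ℓ+1} = P^A_ℓ − ε·[J_s, P^B_ℓ], P^B_{ℓ+1} = P^B_ℓ + ε·[J_s, P^A_ℓ], and P^A_0 = (P^B_0)ᵀ. Define the complex matrices ρ_ℓ := (P^A_ℓ + (P^A_ℓ)ᵀ)/2 − (i/2)·(P^A_ℓ − (P^A_ℓ)ᵀ) and H := −ℏ·J_s. Then for every ℓ ∈ ℕ the discrete von Neumann equation i·ℏ·(ρ_{ℓ+1} − ρ_ℓ) = ε·[H, ρ_ℓ] holds. -/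

import Mathlib

open Matrix

/-- Entrywise complexification of a real matrix. -/
noncomputable def matCplx {n : Type*} (M : Matrix n n ℝ) : Matrix n n ℂ :=
  M.map (Complex.ofReal)

theorem matCplx_add {n : Type*} (M M' : Matrix n n ℝ) :
    matCplx (M + M') = matCplx M + matCplx M' := by
  ext; simp [matCplx]

theorem matCplx_sub {n : Type*} (M M' : Matrix n n ℝ) :
    matCplx (M - M') = matCplx M - matCplx M' := by
  ext; simp [matCplx]

theorem matCplx_smul {n : Type*} (r : ℝ) (M : Matrix n n ℝ) :
    matCplx (r • M) = (r : ℂ) • matCplx M := by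
  ext; simp [matCplx]

theorem matCplx_mul {n : Type*} [Fintype n] (M M' : Matrix n n ℝ) :
    matCplx (M * M') = matCplx M * matCplx M' := by
  ext; simp [matCplx, Matrix.mul_apply]

/-- The relation `P^B = (P^A)ᵀ` is preserved by the coupled recursions. -/
theorem transpose_eq_of_coupled_recursion {N : Type*} [Fintype N]
    {Js : Matrix N N ℝ} (hJs : Jsᵀ = Js) {ε : ℝ} {PA PB : ℕ → Matrix N N ℝ}
    (hA : ∀ ℓ, PA (ℓ + 1) = PA ℓ - ε • (Js * PB ℓ - PB ℓ * Js))
    (hB : ∀ ℓ, PB (ℓ + 1) = PB ℓ + ε • (Js * PA ℓ - PA ℓ * Js))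
    (h0 : PA 0 = (PB 0)ᵀ) (ℓ : ℕ) : (PA ℓ)ᵀ = PB ℓ := by
  induction ℓ with
  | zero => rw [h0, transpose_transpose]
  | succ k ih =>
    have ih' : (PB k)ᵀ = PA k := by rw [← ih, transpose_transpose]
    rw [hA, hB]
    simp only [transpose_sub, transpose_smul, transpose_mul, hJs, ih, ih']
    module

/-- under the coupled recursions
`P^A_{ℓ+1} = P^A_ℓ - ε [J_s, P^B_ℓ]`, `P^B_{ℓ+1} = P^B_ℓ + ε [J_s, P^A_ℓ]`
with `J_s` symmetric and `P^A_0 = (P^B_0)ᵀ`, the complex matrices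
`ρ_ℓ = (P^A_ℓ + (P^A_ℓ)ᵀ)/2 - (i/2)(P^A_ℓ - (P^A_ℓ)ᵀ)` satisfy the discrete
von Neumann equation `i ℏ (ρ_{ℓ+1} - ρ_ℓ) = ε [H, ρ_ℓ]` with `H = -ℏ J_s`. -/
theorem stmt7 {N : Type*} [Fintype N]
    (Js : Matrix N N ℝ) (hJs : Jsᵀ = Js) (ε ℏ : ℝ) (hℏ : 0 < ℏ)
    (PA PB : ℕ → Matrix N N ℝ)
    (hA : ∀ ℓ, PA (ℓ + 1) = PA ℓ - ε • (Js * PB ℓ - PB ℓ * Js))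
    (hB : ∀ ℓ, PB (ℓ + 1) = PB ℓ + ε • (Js * PA ℓ - PA ℓ * Js))
    (h0 : PA 0 = (PB 0)ᵀ)
    (ρ : ℕ → Matrix N N ℂ)
    (hρ : ∀ ℓ, ρ ℓ = ((2 : ℂ)⁻¹) • matCplx (PA ℓ + (PA ℓ)ᵀ) -
      (Complex.I * (2 : ℂ)⁻¹) • matCplx (PA ℓ - (PA ℓ)ᵀ))
    (H : Matrix N N ℂ) (hH : H = -((ℏ : ℂ) • matCplx Js)) :
    ∀ ℓ, (Complex.I * (ℏ : ℂ)) • (ρ (ℓ + 1) - ρ ℓ) = (ε : ℂ) • (H * ρ ℓ - ρ ℓ * H) := by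
  intro ℓ
  have hT := transpose_eq_of_coupled_recursion hJs hA hB h0
  rw [hρ, hρ, hT, hT, hA, hB, hH]
  simp only [matCplx_add, matCplx_sub, matCplx_smul, matCplx_mul,
    Matrix.mul_sub, Matrix.sub_mul, Matrix.mul_add, Matrix.add_mul, Matrix.neg_mul,
    Matrix.mul_neg, Matrix.smul_mul, Matrix.mul_smul]
  match_scalars <;> ring_nf <;> try (rw [Complex.I_sq]; ring)
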